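/- Third Lamé pair: let λ, μ be real with μ ≠ 0, γ = (λ+μ)/μ ≠ 0, let D ⊆ ℝ² be open, and let U₁, U₂, U₃, U₄ : D → ℝ be twice continuously differentiable functions satisfying the Cauchy–Riemann-type system (CR) on D. Define u = −(2/γ)·U₂ − ((2+γ)/γ)·U₃ and v = U₁, and θ = ∂u/∂x + ∂v/∂y. Then (u, v) solves the Lamé equilibrium system in D: Δu + γ·∂θ/∂x = 0 and Δv + γ·∂θ/∂y = 0. -/

import Mathlib

/- Lamé equilibrium pairs built from the components of a monogenic 𝔹-valued
   function (Theorem 1 of [Gr-dop-15]). -/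

noncomputable section

/-- The partial derivative in `x` of a function `ℝ² → ℝ`. -/
def pdx (f : ℝ × ℝ → ℝ) : ℝ × ℝ → ℝ := fun p => fderiv ℝ f p (1, 0)

/-- The partial derivative in `y` of a function `ℝ² → ℝ`. -/
def pdy (f : ℝ × ℝ → ℝ) : ℝ × ℝ → ℝ := fun p => fderiv ℝ f p (0, 1)

/-- The Cauchy–Riemann-type system for the components `U₁, U₂, U₃, U₄`. -/
def CRsys (U₁ U₂ U₃ U₄ : ℝ × ℝ → ℝ) (p : ℝ × ℝ) : Prop :=
  pdy U₁ p = pdx U₃ p ∧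
  pdy U₂ p = pdx U₄ p ∧
  pdy U₃ p = pdx U₁ p - 2 * pdx U₄ p ∧
  pdy U₄ p = pdx U₂ p + 2 * pdx U₃ p

open Filter Topology

lemma pdx_congr {f g : ℝ × ℝ → ℝ} {p : ℝ × ℝ} (h : f =ᶠ[𝓝 p] g) : pdx f p = pdx g p := by
  simp only [pdx, h.fderiv_eq]

lemma pdy_congr {f g : ℝ × ℝ → ℝ} {p : ℝ × ℝ} (h : f =ᶠ[𝓝 p] g) : pdy f p = pdy g p := by
  simp only [pdy, h.fderiv_eq]

lemma fderiv_linear_comb {f g : ℝ × ℝ → ℝ} {p : ℝ × ℝ} (a b : ℝ)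
    (hf : DifferentiableAt ℝ f p) (hg : DifferentiableAt ℝ g p) :
    fderiv ℝ (fun q => a * f q + b * g q) p = a • fderiv ℝ f p + b • fderiv ℝ g p :=
  ((hf.hasFDerivAt.const_mul a).add (hg.hasFDerivAt.const_mul b)).fderiv

lemma pdx_linear_comb {f g : ℝ × ℝ → ℝ} {p : ℝ × ℝ} (a b : ℝ)
    (hf : DifferentiableAt ℝ f p) (hg : DifferentiableAt ℝ g p) :
    pdx (fun q => a * f q + b * g q) p = a * pdx f p + b * pdx g p := by
  simp [pdx, fderiv_linear_comb a b hf hg]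

lemma pdy_linear_comb {f g : ℝ × ℝ → ℝ} {p : ℝ × ℝ} (a b : ℝ)
    (hf : DifferentiableAt ℝ f p) (hg : DifferentiableAt ℝ g p) :
    pdy (fun q => a * f q + b * g q) p = a * pdy f p + b * pdy g p := by
  simp [pdy, fderiv_linear_comb a b hf hg]

lemma ContDiffAt.differentiableAt_fderiv_real {f : ℝ × ℝ → ℝ} {p : ℝ × ℝ}
    (hf : ContDiffAt ℝ 2 f p) : DifferentiableAt ℝ (fderiv ℝ f) p :=
  (hf.fderiv_right (m := 1) (by norm_num)).differentiableAt (by norm_num)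

lemma ContDiffAt.differentiableAt_pdx {f : ℝ × ℝ → ℝ} {p : ℝ × ℝ}
    (hf : ContDiffAt ℝ 2 f p) : DifferentiableAt ℝ (pdx f) p :=
  hf.differentiableAt_fderiv_real.clm_apply (differentiableAt_const _)

lemma ContDiffAt.differentiableAt_pdy {f : ℝ × ℝ → ℝ} {p : ℝ × ℝ}
    (hf : ContDiffAt ℝ 2 f p) : DifferentiableAt ℝ (pdy f) p :=
  hf.differentiableAt_fderiv_real.clm_apply (differentiableAt_const _)

lemma ContDiffAt.pdy_pdx_comm {f : ℝ × ℝ → ℝ} {p : ℝ × ℝ} (hf : ContDiffAt ℝ 2 f p) :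
    pdy (pdx f) p = pdx (pdy f) p := by
  have key (v w : ℝ × ℝ) :
      fderiv ℝ (fun q => fderiv ℝ f q v) p w = fderiv ℝ (fderiv ℝ f) p w v := by
    rw [fderiv_clm_apply hf.differentiableAt_fderiv_real (differentiableAt_const _)]
    simp
  have hsymm : IsSymmSndFDerivAt ℝ f p := hf.isSymmSndFDerivAt (by simp)
  exact (key _ _).trans ((hsymm _ _).trans (key _ _).symm)

/-- Third Lamé pair: with `γ = (λ+μ)/μ ≠ 0`, the pair
`u = −(2/γ)U₂ − ((2+γ)/γ)U₃`, `v = U₁` built from C² components of a monogenic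
function satisfies the Lamé equilibrium system
`Δu + γθₓ = 0`, `Δv + γθ_y = 0`, where `θ = uₓ + v_y`. -/
theorem third_Lame_pair (lam μ : ℝ) (hμ : μ ≠ 0)
    (γ : ℝ) (hγdef : γ = (lam + μ) / μ) (hγ : γ ≠ 0)
    (D : Set (ℝ × ℝ)) (hD : IsOpen D)
    (U₁ U₂ U₃ U₄ : ℝ × ℝ → ℝ)
    (h₁ : ContDiffOn ℝ 2 U₁ D) (h₂ : ContDiffOn ℝ 2 U₂ D)
    (h₃ : ContDiffOn ℝ 2 U₃ D) (h₄ : ContDiffOn ℝ 2 U₄ D)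
    (hCR : ∀ p ∈ D, CRsys U₁ U₂ U₃ U₄ p)
    (u v θ : ℝ × ℝ → ℝ)
    (hu : u = fun p => -(2 / γ) * U₂ p - ((2 + γ) / γ) * U₃ p)
    (hv : v = U₁)
    (hθ : θ = fun p => pdx u p + pdy v p) :
    ∀ p ∈ D,
      pdx (pdx u) p + pdy (pdy u) p + γ * pdx θ p = 0 ∧
      pdx (pdx v) p + pdy (pdy v) p + γ * pdy θ p = 0 := by
  intro p hp
  have near {P : ℝ × ℝ → Prop} (h : ∀ q ∈ D, P q) : ∀ᶠ q in 𝓝 p, P q :=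
    eventually_of_mem (hD.mem_nhds hp) h
  have c₁ : ∀ q ∈ D, ContDiffAt ℝ 2 U₁ q := fun q hq => h₁.contDiffAt (hD.mem_nhds hq)
  have c₂ : ∀ q ∈ D, ContDiffAt ℝ 2 U₂ q := fun q hq => h₂.contDiffAt (hD.mem_nhds hq)
  have c₃ : ∀ q ∈ D, ContDiffAt ℝ 2 U₃ q := fun q hq => h₃.contDiffAt (hD.mem_nhds hq)
  have c₄ : ∀ q ∈ D, ContDiffAt ℝ 2 U₄ q := fun q hq => h₄.contDiffAt (hD.mem_nhds hq)
  have x₁ := (c₁ p hp).differentiableAt_pdx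
  have x₂ := (c₂ p hp).differentiableAt_pdx
  have x₃ := (c₃ p hp).differentiableAt_pdx
  have x₄ := (c₄ p hp).differentiableAt_pdx
  have y₂ := (c₂ p hp).differentiableAt_pdy
  have y₃ := (c₃ p hp).differentiableAt_pdy
  -- the Cauchy–Riemann equations, in the form of identities of germs at `p`
  have e₁ : pdy U₁ =ᶠ[𝓝 p] pdx U₃ := near fun q hq => (hCR q hq).1
  have e₂ : pdy U₂ =ᶠ[𝓝 p] pdx U₄ := near fun q hq => (hCR q hq).2.1
  have e₃ : pdy U₃ =ᶠ[𝓝 p] fun q => 1 * pdx U₁ q + (-2) * pdx U₄ q :=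
    near fun q hq => by linarith [(hCR q hq).2.2.1]
  have e₄ : pdy U₄ =ᶠ[𝓝 p] fun q => 1 * pdx U₂ q + 2 * pdx U₃ q :=
    near fun q hq => by linarith [(hCR q hq).2.2.2]
  have xy₁ : pdy (pdx U₁) p = pdx (pdx U₃) p := by
    rw [(c₁ p hp).pdy_pdx_comm, pdx_congr e₁]
  have xy₂ : pdy (pdx U₂) p = pdx (pdx U₄) p := by
    rw [(c₂ p hp).pdy_pdx_comm, pdx_congr e₂]
  have xy₃ : pdy (pdx U₃) p = 1 * pdx (pdx U₁) p + (-2) * pdx (pdx U₄) p := by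
    rw [(c₃ p hp).pdy_pdx_comm, pdx_congr e₃, pdx_linear_comb _ _ x₁ x₄]
  have xy₄ : pdy (pdx U₄) p = 1 * pdx (pdx U₂) p + 2 * pdx (pdx U₃) p := by
    rw [(c₄ p hp).pdy_pdx_comm, pdx_congr e₄, pdx_linear_comb _ _ x₂ x₃]
  have yy₁ : pdy (pdy U₁) p = pdy (pdx U₃) p := pdy_congr e₁
  have yy₂ : pdy (pdy U₂) p = pdy (pdx U₄) p := pdy_congr e₂
  have yy₃ : pdy (pdy U₃) p = 1 * pdy (pdx U₁) p + (-2) * pdy (pdx U₄) p := by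
    rw [pdy_congr e₃, pdy_linear_comb _ _ x₁ x₄]
  have hu' : u = fun q => -(2 / γ) * U₂ q + (-((2 + γ) / γ)) * U₃ q := by
    rw [hu]; funext q; ring
  have ux : pdx u =ᶠ[𝓝 p] fun q => -(2 / γ) * pdx U₂ q + (-((2 + γ) / γ)) * pdx U₃ q :=
    near fun q hq => by
      rw [hu']
      exact pdx_linear_comb _ _ ((c₂ q hq).differentiableAt (by norm_num))
        ((c₃ q hq).differentiableAt (by norm_num))
  have uy : pdy u =ᶠ[𝓝 p] fun q => -(2 / γ) * pdy U₂ q + (-((2 + γ) / γ)) * pdy U₃ q :=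
    near fun q hq => by
      rw [hu']
      exact pdy_linear_comb _ _ ((c₂ q hq).differentiableAt (by norm_num))
        ((c₃ q hq).differentiableAt (by norm_num))
  have uxx := (pdx_congr ux).trans (pdx_linear_comb _ _ x₂ x₃)
  have uyy := (pdy_congr uy).trans (pdy_linear_comb _ _ y₂ y₃)
  have hθ' : θ =ᶠ[𝓝 p] fun q => -(2 / γ) * pdx U₂ q + (-(2 / γ)) * pdx U₃ q := by
    filter_upwards [ux, e₁] with q hux he
    rw [hθ, hv]
    simp only [hux, he]
    field_simp
    ring
  have θx := (pdx_congr hθ').trans (pdx_linear_comb _ _ x₂ x₃)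
  have θy := (pdy_congr hθ').trans (pdy_linear_comb _ _ x₂ x₃)
  constructor
  · rw [uxx, uyy, θx, yy₂, yy₃, xy₁, xy₄]
    field_simp
    ring
  · rw [hv, θy, yy₁, xy₂, xy₃]
    field_simp
    ring
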